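/- (pr2.) There is a partial recursive function φ : ℕ ⇀ ℕ such that if a ∈ I_prec then φ(a) is defined, φ(a) ∈ C_prec^{ω-rep}, and End(φ(a)) = End(⟨a⟩(⟨⟩)). -/

import Mathlib

namespace Shoen

/-- Kleene application: value of the `e`-th partial recursive function at `n`,
in the standard numbering via `Nat.Partrec.Code`. -/
def peval (e n : ℕ) : Part ℕ := (Denumerable.ofNat Nat.Partrec.Code e).eval n

/-- `e` is an index of a (total) primitive recursive function. -/
def PrimIndex (e : ℕ) : Prop := ∃ f : ℕ → ℕ, Nat.Primrec f ∧ ∀ n, peval e n = Part.some (f n)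

/-- Kleene's relation `<_O`. -/
inductive KLt : ℕ → ℕ → Prop
  | base : KLt 1 2
  | step {a b : ℕ} : KLt a b → KLt b (2 ^ b)
  | lim {e : ℕ} (h : ∀ n, (peval e n).Dom)
      (hm : ∀ n, KLt ((peval e n).get (h n)) ((peval e (n + 1)).get (h (n + 1))))
      (n : ℕ) : KLt ((peval e n).get (h n)) (3 * 5 ^ e)
  | trans {a b c : ℕ} : KLt a b → KLt b c → KLt a c

/-- Kleene's `O`. -/
def KO (a : ℕ) : Prop := KLt a (2 ^ a)

/-- The auxiliary relation `<'_O`. -/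
inductive KLt' : ℕ → ℕ → Prop
  | base : KLt' 1 2
  | step {a b : ℕ} : KLt' a b → KLt' b (2 ^ b)
  | lim {e n x : ℕ} : x ∈ peval e n → KLt' x (3 * 5 ^ e)
  | trans {a b c : ℕ} : KLt' a b → KLt' b c → KLt' a c

/-- The inductive characterization `O'` of Kleene's `O`. -/
inductive KO' : ℕ → Prop
  | one : KO' 1
  | step {a : ℕ} : KO' a → KO' (2 ^ a)
  | lim {e : ℕ} (h : ∀ n, (peval e n).Dom)
      (hm : ∀ n, KLt' ((peval e n).get (h n)) ((peval e (n + 1)).get (h (n + 1)))) :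
      KO' (3 * 5 ^ e)



/-! ### Syntax of first order arithmetic (negation normal form) -/

/-- Terms of the language `0,1,+,×,=`, with de Bruijn variables. -/
inductive Trm : Type
  | var : ℕ → Trm
  | zero : Trm
  | one : Trm
  | add : Trm → Trm → Trm
  | mul : Trm → Trm → Trm
deriving DecidableEq

/-- Formulas in negation normal form: literals (atomic and negated atomic
formulas) combined by `∧, ∨, ∀, ∃` (de Bruijn binders). -/
inductive Fml : Type
  | eq : Trm → Trm → Fml
  | ne : Trm → Trm → Fml
  | and : Fml → Fml → Fml
  | or : Fml → Fml → Fml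
  | all : Fml → Fml
  | ex : Fml → Fml
deriving DecidableEq

/-- All free variables of a term are `< k`. -/
def Trm.cu : Trm → ℕ → Bool
  | .var i, k => decide (i < k)
  | .zero, _ => true
  | .one, _ => true
  | .add s t, k => s.cu k && t.cu k
  | .mul s t, k => s.cu k && t.cu k

/-- All free variables of a formula are `< k`. -/
def Fml.cu : Fml → ℕ → Bool
  | .eq s t, k => s.cu k && t.cu k
  | .ne s t, k => s.cu k && t.cu k
  | .and A B, k => A.cu k && B.cu k
  | .or A B, k => A.cu k && B.cu k
  | .all A, k => A.cu (k + 1)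
  | .ex A, k => A.cu (k + 1)

/-- A sentence is a closed formula. -/
abbrev Sentence : Type := { A : Fml // A.cu 0 = true }

/-- Value of a term under an environment. -/
def Trm.val (ρ : ℕ → ℕ) : Trm → ℕ
  | .var i => ρ i
  | .zero => 0
  | .one => 1
  | .add s t => s.val ρ + t.val ρ
  | .mul s t => s.val ρ * t.val ρ

/-- Extend an environment by a value for variable `0`. -/
def consEnv (n : ℕ) (ρ : ℕ → ℕ) : ℕ → ℕ
  | 0 => n
  | k + 1 => ρ k

/-- Satisfaction in the standard model `ℕ`. -/
def Fml.Sat (ρ : ℕ → ℕ) : Fml → Prop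
  | .eq s t => s.val ρ = t.val ρ
  | .ne s t => s.val ρ ≠ t.val ρ
  | .and A B => A.Sat ρ ∧ B.Sat ρ
  | .or A B => A.Sat ρ ∨ B.Sat ρ
  | .all A => ∀ n : ℕ, A.Sat (consEnv n ρ)
  | .ex A => ∃ n : ℕ, A.Sat (consEnv n ρ)

/-- Truth of a sentence in the standard model. -/
def sentTrue (A : Sentence) : Prop := A.1.Sat (fun _ => 0)

/-- Substitution of a closed term `t` for variable `k` in a term. -/
def Trm.sub (t : Trm) (k : ℕ) : Trm → Trm
  | .var i => if i = k then t else if k < i then .var (i - 1) else .var i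
  | .zero => .zero
  | .one => .one
  | .add s u => .add (Trm.sub t k s) (Trm.sub t k u)
  | .mul s u => .mul (Trm.sub t k s) (Trm.sub t k u)

/-- Substitution of a closed term `t` for variable `k` in a formula. -/
def Fml.sub (t : Trm) : Fml → ℕ → Fml
  | .eq s u, k => .eq (Trm.sub t k s) (Trm.sub t k u)
  | .ne s u, k => .ne (Trm.sub t k s) (Trm.sub t k u)
  | .and A B, k => .and (A.sub t k) (B.sub t k)
  | .or A B, k => .or (A.sub t k) (B.sub t k)
  | .all A, k => .all (A.sub t (k + 1))
  | .ex A, k => .ex (A.sub t (k + 1))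

/-- The numeral `n̄`. -/
def numeral : ℕ → Trm
  | 0 => .zero
  | n + 1 => .add (numeral n) .one

theorem Trm.cu_mono : ∀ (t : Trm) {j k : ℕ}, j ≤ k → t.cu j = true → t.cu k = true := by
  intro t
  induction t with
  | var i =>
    intro j k h ht
    simp only [Trm.cu, decide_eq_true_eq] at *
    omega
  | zero => intros; rfl
  | one => intros; rfl
  | add s u ihs ihu =>
    intro j k h ht
    simp only [Trm.cu, Bool.and_eq_true] at *
    exact ⟨ihs h ht.1, ihu h ht.2⟩
  | mul s u ihs ihu =>
    intro j k h ht
    simp only [Trm.cu, Bool.and_eq_true] at *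
    exact ⟨ihs h ht.1, ihu h ht.2⟩

theorem Trm.cu_sub : ∀ (s : Trm) {k : ℕ} {t : Trm},
    t.cu 0 = true → s.cu (k + 1) = true → (Trm.sub t k s).cu k = true := by
  intro s
  induction s with
  | var i =>
    intro k t ht hs
    simp only [Trm.cu, decide_eq_true_eq] at hs
    simp only [Trm.sub]
    by_cases h : i = k
    · rw [if_pos h]
      exact Trm.cu_mono t (Nat.zero_le k) ht
    · have h2 : ¬ k < i := by omega
      rw [if_neg h, if_neg h2]
      simp only [Trm.cu, decide_eq_true_eq]
      omega
  | zero => intros; rfl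
  | one => intros; rfl
  | add s u ihs ihu =>
    intro k t ht hs
    simp only [Trm.cu, Bool.and_eq_true] at hs
    simp only [Trm.sub, Trm.cu, Bool.and_eq_true]
    exact ⟨ihs ht hs.1, ihu ht hs.2⟩
  | mul s u ihs ihu =>
    intro k t ht hs
    simp only [Trm.cu, Bool.and_eq_true] at hs
    simp only [Trm.sub, Trm.cu, Bool.and_eq_true]
    exact ⟨ihs ht hs.1, ihu ht hs.2⟩

theorem Fml.cu_sub : ∀ (A : Fml) {k : ℕ} {t : Trm},
    t.cu 0 = true → A.cu (k + 1) = true → (A.sub t k).cu k = true := by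
  intro A
  induction A with
  | eq s u =>
    intro k t ht hA
    simp only [Fml.cu, Bool.and_eq_true] at hA
    simp only [Fml.sub, Fml.cu, Bool.and_eq_true]
    exact ⟨Trm.cu_sub s ht hA.1, Trm.cu_sub u ht hA.2⟩
  | ne s u =>
    intro k t ht hA
    simp only [Fml.cu, Bool.and_eq_true] at hA
    simp only [Fml.sub, Fml.cu, Bool.and_eq_true]
    exact ⟨Trm.cu_sub s ht hA.1, Trm.cu_sub u ht hA.2⟩
  | and A B ihA ihB =>
    intro k t ht h
    simp only [Fml.cu, Bool.and_eq_true] at h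
    simp only [Fml.sub, Fml.cu, Bool.and_eq_true]
    exact ⟨ihA ht h.1, ihB ht h.2⟩
  | or A B ihA ihB =>
    intro k t ht h
    simp only [Fml.cu, Bool.and_eq_true] at h
    simp only [Fml.sub, Fml.cu, Bool.and_eq_true]
    exact ⟨ihA ht h.1, ihB ht h.2⟩
  | all A ihA =>
    intro k t ht h
    simp only [Fml.cu] at h
    simp only [Fml.sub, Fml.cu]
    exact ihA ht h
  | ex A ihA =>
    intro k t ht h
    simp only [Fml.cu] at h
    simp only [Fml.sub, Fml.cu]
    exact ihA ht h

theorem numeral_cu : ∀ n : ℕ, (numeral n).cu 0 = true := by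
  intro n
  induction n with
  | zero => rfl
  | succ n ih => simp [numeral, Trm.cu, ih]

/-- Negation (de Morgan dual) of a formula in negation normal form. -/
def Fml.neg : Fml → Fml
  | .eq s t => .ne s t
  | .ne s t => .eq s t
  | .and A B => .or A.neg B.neg
  | .or A B => .and A.neg B.neg
  | .all A => .ex A.neg
  | .ex A => .all A.neg

theorem Fml.cu_neg : ∀ (A : Fml) {k : ℕ}, A.cu k = true → A.neg.cu k = true := by
  intro A
  induction A with
  | eq s u => intro k h; simpa [Fml.cu, Fml.neg] using h
  | ne s u => intro k h; simpa [Fml.cu, Fml.neg] using h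
  | and A B ihA ihB =>
    intro k h
    simp only [Fml.cu, Bool.and_eq_true] at h
    simp only [Fml.neg, Fml.cu, Bool.and_eq_true]
    exact ⟨ihA h.1, ihB h.2⟩
  | or A B ihA ihB =>
    intro k h
    simp only [Fml.cu, Bool.and_eq_true] at h
    simp only [Fml.neg, Fml.cu, Bool.and_eq_true]
    exact ⟨ihA h.1, ihB h.2⟩
  | all A ihA =>
    intro k h
    simp only [Fml.cu] at h
    simp only [Fml.neg, Fml.cu]
    exact ihA h
  | ex A ihA =>
    intro k h
    simp only [Fml.cu] at h
    simp only [Fml.neg, Fml.cu]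
    exact ihA h

/-- Conjunction of sentences. -/
def sAnd (A B : Sentence) : Sentence :=
  ⟨.and A.1 B.1, by simp [Fml.cu, A.2, B.2]⟩

/-- Disjunction of sentences. -/
def sOr (A B : Sentence) : Sentence :=
  ⟨.or A.1 B.1, by simp [Fml.cu, A.2, B.2]⟩

/-- Negation of a sentence. -/
def sNeg (A : Sentence) : Sentence := ⟨A.1.neg, Fml.cu_neg A.1 A.2⟩

/-- The sentence `∀x A(x)`, for `A` with (at most) one free variable. -/
def sAll (A : Fml) (h : A.cu 1 = true) : Sentence := ⟨.all A, by simpa [Fml.cu] using h⟩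

/-- The sentence `∃x A(x)`, for `A` with (at most) one free variable. -/
def sEx (A : Fml) (h : A.cu 1 = true) : Sentence := ⟨.ex A, by simpa [Fml.cu] using h⟩

/-- The instance `A(n̄)` of a formula `A` with one free variable. -/
def sInst (A : Fml) (h : A.cu 1 = true) (n : ℕ) : Sentence :=
  ⟨A.sub (numeral n) 0, Fml.cu_sub A (numeral_cu n) h⟩

/-- Literals: atomic and negated atomic formulas. -/
def Fml.isLiteral : Fml → Bool
  | .eq _ _ => true
  | .ne _ _ => true
  | _ => false

/-- Quantifier free formulas. -/
def Fml.qf : Fml → Bool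
  | .eq _ _ => true
  | .ne _ _ => true
  | .and A B => A.qf && B.qf
  | .or A B => A.qf && B.qf
  | .all _ => false
  | .ex _ => false

/-- An axiom is a sequent containing a true closed literal. -/
def IsAxiom (Γ : Finset Sentence) : Prop :=
  ∃ A ∈ Γ, A.1.isLiteral = true ∧ sentTrue A

/-- A sequent is true if some member is true. -/
def SeqTrue (Γ : Finset Sentence) : Prop := ∃ A ∈ Γ, sentTrue A


/-! ### A primitive recursive Gödel numbering of terms, sentences and sequents -/

/-- Gödel number of a term. -/
def Trm.enc : Trm → ℕ
  | .var i => 5 * i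
  | .zero => 1
  | .one => 2
  | .add s t => 5 * Nat.pair s.enc t.enc + 3
  | .mul s t => 5 * Nat.pair s.enc t.enc + 4

/-- Fuelled decoding of terms. -/
def Trm.dec : ℕ → ℕ → Option Trm
  | 0, _ => none
  | fuel + 1, n =>
    if n % 5 = 0 then some (.var (n / 5))
    else if n % 5 = 1 then some .zero
    else if n % 5 = 2 then some .one
    else if n % 5 = 3 then
      match Trm.dec fuel (n / 5).unpair.1, Trm.dec fuel (n / 5).unpair.2 with
      | some s, some t => some (.add s t)
      | _, _ => none
    else
      match Trm.dec fuel (n / 5).unpair.1, Trm.dec fuel (n / 5).unpair.2 with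
      | some s, some t => some (.mul s t)
      | _, _ => none

theorem Trm.dec_enc : ∀ (t : Trm) (fuel : ℕ), t.enc < fuel → Trm.dec fuel t.enc = some t := by
  intro t
  induction t with
  | var i =>
    intro fuel h
    match fuel with
    | f + 1 =>
      have h0 : (5 * i) % 5 = 0 := by omega
      have h1 : (5 * i) / 5 = i := by omega
      simp [Trm.dec, Trm.enc, h0, h1]
  | zero =>
    intro fuel h
    match fuel with
    | f + 1 => simp [Trm.dec, Trm.enc]
  | one =>
    intro fuel h
    match fuel with
    | f + 1 => simp [Trm.dec, Trm.enc]
  | add s u ihs ihu =>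
    intro fuel h
    match fuel with
    | f + 1 =>
      simp only [Trm.enc] at h ⊢
      set p := Nat.pair s.enc u.enc with hp
      have h0 : (5 * p + 3) % 5 = 3 := by omega
      have h1 : (5 * p + 3) / 5 = p := by omega
      have hs : s.enc < f := by
        have := Nat.left_le_pair s.enc u.enc
        omega
      have hu : u.enc < f := by
        have := Nat.right_le_pair s.enc u.enc
        omega
      simp only [Trm.dec, h0, h1]
      rw [hp, Nat.unpair_pair, ihs f hs, ihu f hu]
      simp
  | mul s u ihs ihu =>
    intro fuel h
    match fuel with
    | f + 1 =>
      simp only [Trm.enc] at h ⊢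
      set p := Nat.pair s.enc u.enc with hp
      have h0 : (5 * p + 4) % 5 = 4 := by omega
      have h1 : (5 * p + 4) / 5 = p := by omega
      have hs : s.enc < f := by
        have := Nat.left_le_pair s.enc u.enc
        omega
      have hu : u.enc < f := by
        have := Nat.right_le_pair s.enc u.enc
        omega
      simp only [Trm.dec, h0, h1]
      rw [hp, Nat.unpair_pair, ihs f hs, ihu f hu]
      simp

instance : Encodable Trm :=
  ⟨Trm.enc, fun n => Trm.dec (n + 1) n, fun t => Trm.dec_enc t _ (Nat.lt_succ_self _)⟩

/-- Gödel number of a formula. -/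
def Fml.enc : Fml → ℕ
  | .eq s t => 6 * Nat.pair s.enc t.enc
  | .ne s t => 6 * Nat.pair s.enc t.enc + 1
  | .and A B => 6 * Nat.pair A.enc B.enc + 2
  | .or A B => 6 * Nat.pair A.enc B.enc + 3
  | .all A => 6 * A.enc + 4
  | .ex A => 6 * A.enc + 5

/-- Fuelled decoding of formulas. -/
def Fml.dec : ℕ → ℕ → Option Fml
  | 0, _ => none
  | fuel + 1, n =>
    if n % 6 = 0 then
      match Encodable.decode (α := Trm) (n / 6).unpair.1,
            Encodable.decode (α := Trm) (n / 6).unpair.2 with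
      | some s, some t => some (.eq s t)
      | _, _ => none
    else if n % 6 = 1 then
      match Encodable.decode (α := Trm) (n / 6).unpair.1,
            Encodable.decode (α := Trm) (n / 6).unpair.2 with
      | some s, some t => some (.ne s t)
      | _, _ => none
    else if n % 6 = 2 then
      match Fml.dec fuel (n / 6).unpair.1, Fml.dec fuel (n / 6).unpair.2 with
      | some A, some B => some (.and A B)
      | _, _ => none
    else if n % 6 = 3 then
      match Fml.dec fuel (n / 6).unpair.1, Fml.dec fuel (n / 6).unpair.2 with
      | some A, some B => some (.or A B)
      | _, _ => none
    else if n % 6 = 4 then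
      match Fml.dec fuel (n / 6) with
      | some A => some (.all A)
      | none => none
    else
      match Fml.dec fuel (n / 6) with
      | some A => some (.ex A)
      | none => none

theorem Fml.dec_enc : ∀ (A : Fml) (fuel : ℕ), A.enc < fuel → Fml.dec fuel A.enc = some A := by
  intro A
  induction A with
  | eq s u =>
    intro fuel h
    match fuel with
    | f + 1 =>
      simp only [Fml.enc] at h ⊢
      set p := Nat.pair s.enc u.enc with hp
      have h0 : (6 * p) % 6 = 0 := by omega
      have h1 : (6 * p) / 6 = p := by omega
      have hds : Encodable.decode (α := Trm) s.enc = some s := Encodable.encodek s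
      have hdu : Encodable.decode (α := Trm) u.enc = some u := Encodable.encodek u
      simp only [Fml.dec, h0, h1]
      rw [hp, Nat.unpair_pair, hds, hdu]
      simp
  | ne s u =>
    intro fuel h
    match fuel with
    | f + 1 =>
      simp only [Fml.enc] at h ⊢
      set p := Nat.pair s.enc u.enc with hp
      have h0 : (6 * p + 1) % 6 = 1 := by omega
      have h1 : (6 * p + 1) / 6 = p := by omega
      have hds : Encodable.decode (α := Trm) s.enc = some s := Encodable.encodek s
      have hdu : Encodable.decode (α := Trm) u.enc = some u := Encodable.encodek u
      simp only [Fml.dec, h0, h1]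
      rw [hp, Nat.unpair_pair, hds, hdu]
      simp
  | and A B ihA ihB =>
    intro fuel h
    match fuel with
    | f + 1 =>
      simp only [Fml.enc] at h ⊢
      set p := Nat.pair A.enc B.enc with hp
      have h0 : (6 * p + 2) % 6 = 2 := by omega
      have h1 : (6 * p + 2) / 6 = p := by omega
      have hA : A.enc < f := by
        have := Nat.left_le_pair A.enc B.enc
        omega
      have hB : B.enc < f := by
        have := Nat.right_le_pair A.enc B.enc
        omega
      simp only [Fml.dec, h0, h1]
      rw [hp, Nat.unpair_pair, ihA f hA, ihB f hB]
      simp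
  | or A B ihA ihB =>
    intro fuel h
    match fuel with
    | f + 1 =>
      simp only [Fml.enc] at h ⊢
      set p := Nat.pair A.enc B.enc with hp
      have h0 : (6 * p + 3) % 6 = 3 := by omega
      have h1 : (6 * p + 3) / 6 = p := by omega
      have hA : A.enc < f := by
        have := Nat.left_le_pair A.enc B.enc
        omega
      have hB : B.enc < f := by
        have := Nat.right_le_pair A.enc B.enc
        omega
      simp only [Fml.dec, h0, h1]
      rw [hp, Nat.unpair_pair, ihA f hA, ihB f hB]
      simp
  | all A ihA =>
    intro fuel h
    match fuel with
    | f + 1 =>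
      simp only [Fml.enc] at h ⊢
      have h0 : (6 * A.enc + 4) % 6 = 4 := by omega
      have h1 : (6 * A.enc + 4) / 6 = A.enc := by omega
      have hA : A.enc < f := by omega
      simp [Fml.dec, h0, h1, ihA f hA]
  | ex A ihA =>
    intro fuel h
    match fuel with
    | f + 1 =>
      simp only [Fml.enc] at h ⊢
      have h0 : (6 * A.enc + 5) % 6 = 5 := by omega
      have h1 : (6 * A.enc + 5) / 6 = A.enc := by omega
      have hA : A.enc < f := by omega
      simp [Fml.dec, h0, h1, ihA f hA]

instance : Encodable Fml :=
  ⟨Fml.enc, fun n => Fml.dec (n + 1) n, fun A => Fml.dec_enc A _ (Nat.lt_succ_self _)⟩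

/-- Gödel number of a sentence. -/
def encF (A : Sentence) : ℕ := Encodable.encode A

/-- Gödel number of a sequent (finite set of sentences). -/
def encS (Γ : Finset Sentence) : ℕ := Encodable.encode Γ

/-- Decode a Gödel number into a sentence (with a default value). -/
def decF (n : ℕ) : Sentence := (Encodable.decode (α := Sentence) n).getD ⟨.eq .zero .zero, rfl⟩

/-- Decode a Gödel number into a sequent (with a default value). -/
def decS (n : ℕ) : Finset Sentence := (Encodable.decode (α := Finset Sentence) n).getD ∅

/-! ### Tupling of natural numbers, with projections -/

/-- Code of a finite sequence (tuple) of natural numbers; codes are nonzero. -/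
def tup (l : List ℕ) : ℕ := Encodable.encode l + 1

/-- The finite sequence coded by a natural number. -/
def untup (a : ℕ) : List ℕ := Denumerable.ofNat (List ℕ) (a - 1)

/-- The `i`-th projection `(a)_i`. -/
def proj (a i : ℕ) : ℕ := (untup a).getD i 0

/-- `a` codes a finite sequence (every nonzero number does, bijectively). -/
def InSeq (a : ℕ) : Prop := a ≠ 0

/-- The code of the empty sequence `⟨⟩` (the root). -/
def rootSeq : ℕ := tup []

/-- The code of `σ⌢i`. -/
def snoc (σ i : ℕ) : ℕ := tup (untup σ ++ [i])

/-! ### Names for the inference rules -/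

def axC : ℕ := 1
def andC : ℕ := 2
def orC : ℕ := 3
def omC : ℕ := 4
def exC : ℕ := 5
def cutC : ℕ := 6
def omrepC : ℕ := 7

/-- The end sequent of a (code of a) proof or proof node: `(a)_1` if the rule
`(a)_0` carries no main formula, and `(a)_1 ∪ {(a)_2}` otherwise. -/
def EndS (a : ℕ) : Finset Sentence :=
  if proj a 0 = cutC ∨ proj a 0 = axC ∨ proj a 0 = omrepC then decS (proj a 1)
  else decS (proj a 1) ∪ {decF (proj a 2)}

/-! ### Local codes of ω-proofs -/

/-- Local codes of `ω`-proofs, in Tait style.  The three `Bool` parameters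
respectively allow the cut rule, restrict the `ω`-rule to indices of primitive
recursive functions, and allow the vacuous `ω`-repetition rule. -/
inductive CGen (c p r : Bool) : ℕ → Prop
  | ax (Γ : Finset Sentence) (h : IsAxiom Γ) : CGen c p r (tup [axC, encS Γ])
  | and {a b : ℕ} (Γ : Finset Sentence) (A B : Sentence)
      (ha : CGen c p r a) (hb : CGen c p r b)
      (ea : EndS a = Γ ∪ {A}) (eb : EndS b = Γ ∪ {B}) :
      CGen c p r (tup [andC, encS Γ, encF (sAnd A B), a, b])
  | or {a : ℕ} (Γ : Finset Sentence) (A B : Sentence) (ha : CGen c p r a)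
      (ea : EndS a = Γ ∪ {A, B}) :
      CGen c p r (tup [orC, encS Γ, encF (sOr A B), a])
  | om {e : ℕ} (Γ : Finset Sentence) (A : Fml) (hA : A.cu 1 = true)
      (hp : p = true → PrimIndex e)
      (htot : ∀ n, (peval e n).Dom)
      (hmem : ∀ n, CGen c p r ((peval e n).get (htot n)))
      (hend : ∀ n, EndS ((peval e n).get (htot n)) = Γ ∪ {sInst A hA n}) :
      CGen c p r (tup [omC, encS Γ, encF (sAll A hA), e])
  | ex {a : ℕ} (Γ : Finset Sentence) (A : Fml) (hA : A.cu 1 = true) (n : ℕ)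
      (ha : CGen c p r a) (ea : EndS a = Γ ∪ {sInst A hA n}) :
      CGen c p r (tup [exC, encS Γ, encF (sEx A hA), a])
  | cut {a b : ℕ} (hc : c = true) (Γ : Finset Sentence) (C : Sentence)
      (ha : CGen c p r a) (hb : CGen c p r b)
      (ea : EndS a = Γ ∪ {C}) (eb : EndS b = Γ ∪ {sNeg C}) :
      CGen c p r (tup [cutC, encS Γ, encF C, a, b])
  | omrep {e : ℕ} (hr : r = true) (Γ : Finset Sentence) (hp : PrimIndex e)
      (htot : ∀ n, (peval e n).Dom)
      (hmem : ∀ n, CGen c p r ((peval e n).get (htot n)))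
      (hend : ∀ n, EndS ((peval e n).get (htot n)) = Γ) :
      CGen c p r (tup [omrepC, encS Γ, e])

/-- `C_rec`: recursive local codes of `ω`-proofs. -/
def Crec : ℕ → Prop := CGen true false false

/-- `C_rec^-`: the cut free fragment of `C_rec`. -/
def CrecM : ℕ → Prop := CGen false false false

/-- `C_prec`: primitive recursive local codes of `ω`-proofs. -/
def Cprec : ℕ → Prop := CGen true true false

/-- `C_prec^-`: the cut free fragment of `C_prec`. -/
def CprecM : ℕ → Prop := CGen false true false

/-- `C_prec^{ω-rep}`: `C_prec` with the vacuous `ω`-repetition rule. -/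
def CprecRep : ℕ → Prop := CGen true true true

/-! ### ω-proofs as well founded trees of sequents -/

/-- `σ` is a node of the tree `T_π = {σ ∈ Seq : π(σ) ∈ Seq}`. -/
def TreeOf (π : ℕ → ℕ) (σ : ℕ) : Prop := σ ≠ 0 ∧ π σ ≠ 0

/-- The tree `T_π` is well founded: it has no infinite branch. -/
def WFTree (π : ℕ → ℕ) : Prop :=
  ¬ ∃ f : ℕ → ℕ, ∀ n : ℕ, TreeOf π (tup ((List.range n).map f))

/-- The inference at an inner node of an `ω`-proof is a correct instance of one
of the rules of Tait-style `ω`-arithmetic. -/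
def CorrectInner (π : ℕ → ℕ) (σ : ℕ) : Prop :=
  (∃ (Γ : Finset Sentence) (A B : Sentence),
    π σ = tup [andC, encS Γ, encF (sAnd A B)] ∧
    TreeOf π (snoc σ 0) ∧ TreeOf π (snoc σ 1) ∧ ¬ TreeOf π (snoc σ 2) ∧
    EndS (π (snoc σ 0)) = Γ ∪ {A} ∧ EndS (π (snoc σ 1)) = Γ ∪ {B}) ∨
  (∃ (Γ : Finset Sentence) (A B : Sentence),
    π σ = tup [orC, encS Γ, encF (sOr A B)] ∧
    TreeOf π (snoc σ 0) ∧ ¬ TreeOf π (snoc σ 1) ∧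
    EndS (π (snoc σ 0)) = Γ ∪ {A, B}) ∨
  (∃ (Γ : Finset Sentence) (A : Fml) (hA : A.cu 1 = true),
    π σ = tup [omC, encS Γ, encF (sAll A hA)] ∧
    (∀ n : ℕ, TreeOf π (snoc σ n)) ∧
    (∀ n : ℕ, EndS (π (snoc σ n)) = Γ ∪ {sInst A hA n})) ∨
  (∃ (Γ : Finset Sentence) (A : Fml) (hA : A.cu 1 = true) (n : ℕ),
    π σ = tup [exC, encS Γ, encF (sEx A hA)] ∧
    TreeOf π (snoc σ 0) ∧ ¬ TreeOf π (snoc σ 1) ∧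
    EndS (π (snoc σ 0)) = Γ ∪ {sInst A hA n}) ∨
  (∃ (Γ : Finset Sentence) (C : Sentence),
    π σ = tup [cutC, encS Γ, encF C] ∧
    TreeOf π (snoc σ 0) ∧ TreeOf π (snoc σ 1) ∧ ¬ TreeOf π (snoc σ 2) ∧
    EndS (π (snoc σ 0)) = Γ ∪ {C} ∧ EndS (π (snoc σ 1)) = Γ ∪ {sNeg C})

/-- Local correctness of a function `π : ℕ → ℕ` viewed as a tree of sequents:
all conditions in the definition of `ω`-proof except well-foundedness. -/
structure LocallyCorrect (π : ℕ → ℕ) : Prop where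
  /-- values outside `Seq` are `0` -/
  nonseq : ∀ σ, ¬ InSeq (π σ) → π σ = 0
  /-- `T_π` is closed under initial segments -/
  downward : ∀ σ τ, TreeOf π σ → τ ≠ 0 → untup τ <+: untup σ → TreeOf π τ
  /-- children come first -/
  mono : ∀ σ i j, i < j → TreeOf π (snoc σ j) → TreeOf π (snoc σ i)
  /-- top nodes are axioms -/
  top : ∀ σ, TreeOf π σ → ¬ TreeOf π (snoc σ 0) →
    ∃ Γ : Finset Sentence, IsAxiom Γ ∧ π σ = tup [axC, encS Γ]
  /-- inner nodes are correct inferences -/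
  inner : ∀ σ, TreeOf π σ → TreeOf π (snoc σ 0) → CorrectInner π σ

/-- `π : ℕ → ℕ` is an `ω`-proof. -/
structure IsOmegaProof (π : ℕ → ℕ) extends LocallyCorrect π : Prop where
  /-- the tree `T_π` is well founded -/
  wf : WFTree π

/-- An `ω`-proof is cut free if no node is labelled `cut`. -/
def CutFree (π : ℕ → ℕ) : Prop := ∀ σ, TreeOf π σ → proj (π σ) 0 ≠ cutC

/-! ### The ω-proof `π(a)` coded by a local code `a` -/

open Classical in
/-- The code of the subproof at child `n` of the proof coded by `a`. -/
noncomputable def childCode (a n : ℕ) : ℕ :=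
  if proj a 0 = omC then
    (if h : (peval (proj a 3) n).Dom then (peval (proj a 3) n).get h else 0)
  else if proj a 0 = andC ∨ proj a 0 = orC ∨ proj a 0 = exC ∨ proj a 0 = cutC then
    proj a (n + 3)
  else 0

/-- Walk down a local code along a path. -/
noncomputable def walkCode (a : ℕ) : List ℕ → ℕ
  | [] => a
  | i :: l => walkCode (childCode a i) l

/-- The node label `⟨R,Γ,A⟩` (or `⟨Ax,Γ⟩`) determined by a local code. -/
def nodeVal (b : ℕ) : ℕ :=
  if proj b 0 = axC then tup [axC, proj b 1]
  else if proj b 0 = andC ∨ proj b 0 = orC ∨ proj b 0 = omC ∨ proj b 0 = exC ∨ proj b 0 = cutC then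
    tup [proj b 0, proj b 1, proj b 2]
  else 0

/-- The `ω`-proof `π(a)` determined by a local code `a` (with value `0` at all
other arguments). -/
noncomputable def piOf (a : ℕ) (σ : ℕ) : ℕ :=
  if σ = 0 then 0 else nodeVal (walkCode a (untup σ))

/-! ### Indices (global codes) of recursive and primitive recursive ω-proofs -/

/-- `I_rec`: `a` is an index of a recursive `ω`-proof. -/
def Irec (a : ℕ) : Prop :=
  ∃ h : ∀ n, (peval a n).Dom, IsOmegaProof (fun n => (peval a n).get (h n))

/-- `I_prec`: `a` is an index of a primitive recursive `ω`-proof. -/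
def Iprec (a : ℕ) : Prop :=
  ∃ f : ℕ → ℕ, Nat.Primrec f ∧ (∀ n, peval a n = Part.some (f n)) ∧ IsOmegaProof f

/-- `I_prec^-`: `a` is an index of a primitive recursive cut free `ω`-proof. -/
def IprecM (a : ℕ) : Prop :=
  ∃ f : ℕ → ℕ, Nat.Primrec f ∧ (∀ n, peval a n = Part.some (f n)) ∧
    IsOmegaProof f ∧ CutFree f

/-! ### Ordinal lengths -/

open Classical in
/-- `x + 1` if `P` holds, and `0` otherwise. -/
noncomputable def succIf (P : Prop) (x : Ordinal.{0}) : Ordinal.{0} :=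
  if P then x + 1 else 0

/-- The ordinal rank of a node of the tree `T_π`:
`rank σ = sup {rank (σ⌢i) + 1 : σ⌢i ∈ T_π}`. -/
inductive NodeRank (π : ℕ → ℕ) : ℕ → Ordinal.{0} → Prop
  | mk (σ : ℕ) (o : ℕ → Ordinal.{0})
      (h : ∀ i, TreeOf π (snoc σ i) → NodeRank π (snoc σ i) (o i)) :
      NodeRank π σ (⨆ i, succIf (TreeOf π (snoc σ i)) (o i))

/-- The ordinal length of a local code:  `|⟨Ax,Γ⟩| = 0`,
`|⟨R,Γ,A,a₁,…,a_k⟩| = sup{|a₁|,…,|a_k|} + 1`, and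
`|⟨ω,Γ,∀xA(x),e⟩| = sup{|⟨e⟩(n)| + 1 : n ∈ ℕ}`. -/
inductive CLen : ℕ → Ordinal.{0} → Prop
  | ax (g : ℕ) : CLen (tup [axC, g]) 0
  | one (R g x a : ℕ) (o : Ordinal.{0}) (hR : R = orC ∨ R = exC) (h : CLen a o) :
      CLen (tup [R, g, x, a]) (o + 1)
  | two (R g x a b : ℕ) (oa ob : Ordinal.{0}) (hR : R = andC ∨ R = cutC)
      (ha : CLen a oa) (hb : CLen b ob) :
      CLen (tup [R, g, x, a, b]) ((oa ⊔ ob) + 1)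
  | om (g x e : ℕ) (h : ∀ n, (peval e n).Dom) (o : ℕ → Ordinal.{0})
      (ho : ∀ n, CLen ((peval e n).get (h n)) (o n)) :
      CLen (tup [omC, g, x, e]) (⨆ n, o n + 1)

/-- The ordinal `|a|` of a notation `a ∈ O`:  `|1| = 0`, `|2^a| = |a| + 1`,
`|3·5^e| = sup{|⟨e⟩(n)| : n ∈ ℕ}`. -/
inductive KOrd : ℕ → Ordinal.{0} → Prop
  | one : KOrd 1 0
  | step {a : ℕ} {o : Ordinal.{0}} : KOrd a o → KOrd (2 ^ a) (o + 1)
  | lim {e : ℕ} (h : ∀ n, (peval e n).Dom) (o : ℕ → Ordinal.{0})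
      (ho : ∀ n, KOrd ((peval e n).get (h n)) (o n)) :
      KOrd (3 * 5 ^ e) (⨆ n, o n)


open Classical in
/-- One step of the sequence `a(f)` determined by a local code. -/
noncomputable def branchStep (b k : ℕ) : Option ℕ :=
  if (∃ (Γ : Finset Sentence) (A B : Sentence) (b₀ b₁ : ℕ),
        b = tup [andC, encS Γ, encF (sAnd A B), b₀, b₁]) ∨
     (∃ (Γ : Finset Sentence) (C : Sentence) (b₀ b₁ : ℕ),
        b = tup [cutC, encS Γ, encF C, b₀, b₁]) then
    some (proj b (3 + k % 2))
  else if ∃ (Γ : Finset Sentence) (A B : Sentence) (c : ℕ),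
      b = tup [orC, encS Γ, encF (sOr A B), c] then
    some (proj b 3)
  else if ∃ (Γ : Finset Sentence) (A : Fml) (hA : A.cu 1 = true) (e : ℕ),
      b = tup [omC, encS Γ, encF (sAll A hA), e] then
    (if h : (peval (proj b 3) k).Dom then some ((peval (proj b 3) k).get h) else none)
  else none

/-- The sequence `a(f) = ⟨a₀,a₁,…⟩`:  `chain a f i = some aᵢ` if the `i`-th
element of the sequence is defined, and `none` otherwise. -/
noncomputable def chain (a : ℕ) (f : ℕ → ℕ) : ℕ → Option ℕ
  | 0 => some a
  | i + 1 =>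
    match chain a f i with
    | none => none
    | some b => branchStep b (f i)

/-! ### Primitive recursive computation of end sequents -/

theorem encode_list_map_encF (l : List Sentence) :
    Encodable.encode (l.map encF) = Encodable.encode l := by
  induction l with
  | nil => rfl
  | cons A l ih => simp [Encodable.encode_list_cons, ih, encF]

theorem encF_injective : Function.Injective encF := Encodable.encode_injective

theorem decS_encS (Γ : Finset Sentence) : decS (encS Γ) = Γ := by simp [decS, encS]

theorem decF_encF (A : Sentence) : decF (encF A) = A := by simp [decF, encF]

/-- The Gödel number of a sequent codes a list enumerating it in the order of Gödel numbers. -/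
theorem exists_list_encS (Γ : Finset Sentence) :
    ∃ l : List Sentence, encS Γ = Encodable.encode l ∧ (l : Multiset Sentence) = Γ.val ∧
      l.Pairwise (fun A B => encF A ≤ encF B) := by
  let r : Sentence → Sentence → Prop := fun A B => encF A ≤ encF B
  have : IsTrans Sentence r := ⟨fun _ _ _ => le_trans⟩
  have : Std.Antisymm r := ⟨fun _ _ h₁ h₂ => encF_injective (le_antisymm h₁ h₂)⟩
  have : Std.Total r := ⟨fun _ _ => le_total _ _⟩
  let : DecidableRel r := fun A B => Nat.decLe (encF A) (encF B)
  exact ⟨Γ.val.sort r, rfl, Multiset.sort_eq _ _, Multiset.pairwise_sort _ _⟩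

theorem encS_toFinset {l : List Sentence} (hl : l.Pairwise (fun A B => encF A < encF B)) :
    encS l.toFinset = Encodable.encode (l.map encF) := by
  obtain ⟨l', he, hv, hs⟩ := exists_list_encS l.toFinset
  have hn : l.Nodup := hl.imp fun h e => by simp [e] at h
  have hp : l'.Perm l := by
    rw [← Multiset.coe_eq_coe, hv, List.toFinset_val, hn.dedup]
  have : l' = l := hp.eq_of_pairwise
    (fun A B _ _ h₁ h₂ => encF_injective (le_antisymm h₁ h₂)) hs (hl.imp le_of_lt)
  rw [he, this, encode_list_map_encF]

theorem exists_sorted_list (Γ : Finset Sentence) :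
    ∃ l : List Sentence, l.toFinset = Γ ∧ l.Pairwise (fun A B => encF A < encF B) := by
  obtain ⟨l, -, hv, hs⟩ := exists_list_encS Γ
  have hn : l.Nodup := by
    rw [← Multiset.coe_nodup, hv]
    exact Γ.nodup
  refine ⟨l, ?_, ?_⟩
  · ext A
    rw [List.mem_toFinset, ← Multiset.mem_coe, hv, Finset.mem_val]
  · exact hs.imp₂ (fun A B h₁ h₂ => lt_of_le_of_ne h₁ (encF_injective.ne h₂)) hn

/-- Insertion of a sentence into a sequent, on Gödel numbers. -/
def insertCode (s x : ℕ) : ℕ :=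
  Encodable.encode ((Denumerable.ofNat (List ℕ) s).filter (· < x) ++
    x :: (Denumerable.ofNat (List ℕ) s).filter (fun y => ¬ y ≤ x))

theorem insertCode_encS (Γ : Finset Sentence) (A : Sentence) :
    insertCode (encS Γ) (encF A) = encS (Γ ∪ {A}) := by
  obtain ⟨l, rfl, hl⟩ := exists_sorted_list Γ
  have hu : l.toFinset ∪ {A} = (l.filter (fun B => encF B < encF A) ++
      A :: l.filter (fun B => ¬ encF B ≤ encF A)).toFinset := by
    ext B
    have := (encF_injective.eq_iff (a := B) (b := A)).symm
    simp only [Finset.mem_union, List.mem_toFinset, Finset.mem_singleton, List.mem_append,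
      List.mem_cons, List.mem_filter, decide_eq_true_eq]
    grind
  have hs : (l.filter (fun B => encF B < encF A) ++
      A :: l.filter (fun B => ¬ encF B ≤ encF A)).Pairwise (fun A B => encF A < encF B) := by
    refine List.pairwise_append.2 ⟨hl.filter _, List.pairwise_cons.2 ⟨?_, hl.filter _⟩, ?_⟩
    · simp
    · intro B hB C hC
      simp only [List.mem_filter, List.mem_cons, decide_eq_true_eq] at hB hC
      grind
  rw [hu, encS_toFinset hs, encS_toFinset hl, insertCode, Denumerable.ofNat_encode]
  simp [List.filter_map, Function.comp_def]

theorem primrec₂_insertCode : Primrec₂ insertCode := by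
  have hl : Primrec fun p : ℕ × ℕ => Denumerable.ofNat (List ℕ) p.1 :=
    (Primrec.ofNat _).comp Primrec.fst
  have hlt : PrimrecRel fun a b : ℕ => a < b := Primrec.nat_lt
  have hgt : PrimrecRel fun a b : ℕ => ¬ a ≤ b := Primrec.nat_le.not
  exact Primrec.encode.comp (Primrec.list_append.comp (hlt.listFilter.comp hl Primrec.snd)
    (Primrec.list_cons.comp Primrec.snd (hgt.listFilter.comp hl Primrec.snd)))

theorem primrec_untup : Primrec untup :=
  (Primrec.ofNat _).comp Primrec.pred

theorem primrec_tup : Primrec tup := Primrec.succ.comp Primrec.encode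

theorem primrec₂_proj : Primrec₂ proj :=
  (Primrec.list_getD 0).comp (primrec_untup.comp Primrec.fst) Primrec.snd

theorem primrec₂_snoc : Primrec₂ snoc :=
  primrec_tup.comp (Primrec.list_append.comp (primrec_untup.comp Primrec.fst)
    (Primrec.list_cons.comp Primrec.snd (Primrec.const [])))

theorem untup_tup (l : List ℕ) : untup (tup l) = l := by simp [untup, tup]

/-- The Gödel number of the end sequent of a node label. -/
def endCode (v : ℕ) : ℕ :=
  if proj v 0 = cutC ∨ proj v 0 = axC ∨ proj v 0 = omrepC then proj v 1
  else insertCode (proj v 1) (proj v 2)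

theorem primrec_proj {α : Type*} [Primcodable α] {g : α → ℕ} (hg : Primrec g) (i : ℕ) :
    Primrec fun x => proj (g x) i :=
  primrec₂_proj.comp hg (Primrec.const i)

theorem primrecPred_rule {α : Type*} [Primcodable α] {g : α → ℕ} (hg : Primrec g) (R : ℕ) :
    PrimrecPred fun x => proj (g x) 0 = R :=
  Primrec.eq.comp (primrec_proj hg 0) (Primrec.const R)

theorem primrec_endCode : Primrec endCode :=
  Primrec.ite ((primrecPred_rule Primrec.id _).or
      ((primrecPred_rule Primrec.id _).or (primrecPred_rule Primrec.id _)))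
    (primrec_proj Primrec.id 1) (primrec₂_insertCode.comp (primrec_proj Primrec.id 1) (primrec_proj Primrec.id 2))

/-! ### Labels of ω-proofs -/

theorem exists_label {f : ℕ → ℕ} (hf : IsOmegaProof f) {σ : ℕ} (hσ : TreeOf f σ) :
    (∃ Γ, f σ = tup [axC, encS Γ]) ∨ ∃ R Γ A, f σ = tup [R, encS Γ, encF A] := by
  by_cases h0 : TreeOf f (snoc σ 0)
  · right
    rcases hf.inner σ hσ h0 with ⟨Γ, A, B, h, -⟩ | ⟨Γ, A, B, h, -⟩ | ⟨Γ, A, hA, h, -⟩ |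
      ⟨Γ, A, hA, n, h, -⟩ | ⟨Γ, C, h, -⟩ <;> exact ⟨_, _, _, h⟩
  · obtain ⟨Γ, -, h⟩ := hf.top σ hσ h0
    exact Or.inl ⟨Γ, h⟩

theorem endCode_label {f : ℕ → ℕ} (hf : IsOmegaProof f) {σ : ℕ} (hσ : TreeOf f σ) :
    endCode (f σ) = encS (EndS (f σ)) := by
  rcases exists_label hf hσ with ⟨Γ, h⟩ | ⟨R, Γ, A, h⟩
  · simp [h, endCode, EndS, proj, untup_tup, decS_encS]
  · by_cases hR : R = cutC ∨ R = axC ∨ R = omrepC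
    · simp [h, endCode, EndS, proj, untup_tup, decS_encS, hR]
    · simp only [h, endCode, EndS, proj, untup_tup, List.getD_cons_zero, List.getD_cons_succ, hR,
        if_false, decS_encS, decF_encF, insertCode_encS]

/-- Bar induction along the tree of an `ω`-proof. -/
theorem IsOmegaProof.tree_induction {f : ℕ → ℕ} (hf : IsOmegaProof f) {P : ℕ → Prop}
    (step : ∀ σ, TreeOf f σ → (∀ i, TreeOf f (snoc σ i) → P (snoc σ i)) → P σ)
    (hr : TreeOf f rootSeq) : P rootSeq := by
  by_contra hP
  have ext : ∀ l : {l : List ℕ // TreeOf f (tup l) ∧ ¬ P (tup l)},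
      ∃ i, TreeOf f (tup (l.1 ++ [i])) ∧ ¬ P (tup (l.1 ++ [i])) := by
    rintro ⟨l, hl, hPl⟩
    by_contra! h
    refine hPl (step _ hl fun i hi => ?_)
    simp only [snoc, untup_tup] at hi ⊢
    exact h i hi
  choose next hnext using ext
  let path : ℕ → {l : List ℕ // TreeOf f (tup l) ∧ ¬ P (tup l)} :=
    fun n => n.rec ⟨[], hr, hP⟩ fun _ l => ⟨l.1 ++ [next l], hnext l⟩
  refine hf.wf ⟨fun n => next (path n), fun n => ?_⟩
  have : (List.range n).map (fun n => next (path n)) = (path n).1 := by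
    induction n with
    | zero => rfl
    | succ n ih => simp [List.range_succ, ih, path]
  rw [this]
  exact (path n).2.1

/-- The end sequent of the label `0`, which lies outside every tree, is an axiom. -/
theorem isAxiom_endS_zero : IsAxiom (EndS 0) := by
  have h : EndS 0 = {⟨.eq .zero .zero, rfl⟩} := by
    have hS : decS 0 = ∅ := by
      have h : encS ∅ = 0 := encS_toFinset List.Pairwise.nil
      rw [← h, decS_encS]
    have hF : decF 0 = ⟨.eq .zero .zero, rfl⟩ := by decide
    have h0 : ∀ i, proj 0 i = 0 := by simp [proj, untup]
    simp [EndS, h0, cutC, axC, omrepC, hS, hF]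
  rw [h]
  exact ⟨_, Finset.mem_singleton_self _, rfl, rfl⟩

/-! ### The translation of indices into local codes -/

open Nat.Partrec (Code)

/-- The index obtained from the index `c` by fixing the first argument to be `m`. -/
def curryIndex (c m : ℕ) : ℕ := Encodable.encode (Code.curry (Denumerable.ofNat Code c) m)

theorem peval_encode (c : Code) (n : ℕ) : peval (Encodable.encode c) n = c.eval n := by
  rw [peval, Denumerable.ofNat_encode]

theorem peval_curryIndex (c : Code) (m n : ℕ) :
    peval (curryIndex (Encodable.encode c) m) n = c.eval (Nat.pair m n) := by
  rw [curryIndex, peval_encode, Denumerable.ofNat_encode, Code.eval_curry]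

theorem primrec₂_curryIndex : Primrec₂ curryIndex :=
  Primrec.encode.comp (Code.primrec₂_curry.comp ((Primrec.ofNat Code).comp Primrec.fst) Primrec.snd)

theorem partrec₂_peval : Partrec₂ peval :=
  Code.eval_part.comp ((Primrec.ofNat Code).comp Primrec.fst).to_comp Primrec.snd.to_comp

/-- The local code of the subproof at the node `σ` with label `v` of the `ω`-proof with index `a`:
a repetition whose premises are computed by the index `c`. -/
def delayedCode (c a σ v : ℕ) : ℕ :=
  tup [omrepC, endCode v, curryIndex c (Nat.pair a σ)]

theorem primrec_delayedCode {α : Type*} [Primcodable α] {c a σ v : α → ℕ} (hc : Primrec c)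
    (ha : Primrec a) (hσ : Primrec σ) (hv : Primrec v) :
    Primrec fun x => delayedCode (c x) (a x) (σ x) (v x) :=
  primrec_tup.comp (Primrec.list_cons.comp (Primrec.const _) (Primrec.list_cons.comp
    (primrec_endCode.comp hv) (Primrec.list_cons.comp (primrec₂_curryIndex.comp hc
      (Primrec₂.natPair.comp ha hσ)) (Primrec.const []))))

/-- The local codes of all immediate subproofs of a node: the argument codes an index `c` as in
`delayedCode`, the index `a` of the `ω`-proof, the node and the number of the child. -/
def childFun (m : ℕ) : Part ℕ :=
  let q := m.unpair.1.unpair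
  let σ := snoc q.2.unpair.2 m.unpair.2
  (peval q.2.unpair.1 σ).map (delayedCode q.1 q.2.unpair.1 σ)

theorem childFun_pair (c a σ n : ℕ) :
    childFun (Nat.pair (Nat.pair c (Nat.pair a σ)) n) =
      (peval a (snoc σ n)).map (delayedCode c a (snoc σ n)) := by
  simp [childFun]

theorem partrec_childFun : Partrec childFun := by
  have hq : Primrec fun m : ℕ => m.unpair.1.unpair :=
    Primrec.unpair.comp (Primrec.fst.comp Primrec.unpair)
  have hc := Primrec.fst.comp hq
  have hr := Primrec.unpair.comp (Primrec.snd.comp hq)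
  have ha := Primrec.fst.comp hr
  have hσ := primrec₂_snoc.comp (Primrec.snd.comp hr) (Primrec.snd.comp Primrec.unpair)
  exact (partrec₂_peval.comp ha.to_comp hσ.to_comp).map
    (primrec_delayedCode (hc.comp Primrec.fst) (ha.comp Primrec.fst) (hσ.comp Primrec.fst)
      Primrec.snd).to_comp

/-- The local code of a node with label `v`, where `x` and `y` are the local codes of the first two
subproofs and `e` is an index for the local codes of all subproofs. -/
def nodeCode (v x y e : ℕ) : ℕ :=
  if proj v 0 = axC then v
  else if proj v 0 = omC then tup [omC, proj v 1, proj v 2, e]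
  else if proj v 0 = orC ∨ proj v 0 = exC then tup [proj v 0, proj v 1, proj v 2, x]
  else tup [proj v 0, proj v 1, proj v 2, x, y]

theorem primrec_nodeCode {α : Type*} [Primcodable α] {v x y e : α → ℕ} (hv : Primrec v)
    (hx : Primrec x) (hy : Primrec y) (he : Primrec e) :
    Primrec fun t => nodeCode (v t) (x t) (y t) (e t) := by
  have label : ∀ {R : α → ℕ} {l : α → List ℕ}, Primrec R → Primrec l →
      Primrec fun t => tup (R t :: proj (v t) 1 :: proj (v t) 2 :: l t) := fun hR hl =>
    primrec_tup.comp (Primrec.list_cons.comp hR (Primrec.list_cons.comp (primrec_proj hv 1)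
      (Primrec.list_cons.comp (primrec_proj hv 2) hl)))
  have sing : ∀ {z : α → ℕ}, Primrec z → Primrec fun t => [z t] := fun hz =>
    Primrec.list_cons.comp hz (Primrec.const [])
  exact Primrec.ite (primrecPred_rule hv _) hv
    (Primrec.ite (primrecPred_rule hv _) (label (Primrec.const _) (sing he))
      (Primrec.ite ((primrecPred_rule hv _).or (primrecPred_rule hv _))
        (label (primrec_proj hv 0) (sing hx))
        (label (primrec_proj hv 0) (Primrec.list_cons.comp hx (sing hy)))))

/-- The step of the translation: the argument codes the index `a` of the `ω`-proof, the node and a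
number that is ignored. Here `d` is a code of `childFun`. -/
def stepFun (d : Code) (c : Code) (m : ℕ) : Part ℕ :=
  let a := m.unpair.1.unpair.1
  let σ := m.unpair.1.unpair.2
  let q := Nat.pair (Encodable.encode c) m.unpair.1
  (peval a σ).bind fun v => (childFun (Nat.pair q 0)).bind fun x =>
    (childFun (Nat.pair q 1)).map fun y => nodeCode v x y (curryIndex (Encodable.encode d) q)

theorem partrec₂_stepFun (d : Code) : Partrec₂ (stepFun d) := by
  have hm : Primrec fun p : Code × ℕ => p.2.unpair.1 :=
    Primrec.fst.comp (Primrec.unpair.comp Primrec.snd)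
  have hu := Primrec.unpair.comp hm
  have hq : Primrec fun p : Code × ℕ => Nat.pair (Encodable.encode p.1) p.2.unpair.1 :=
    Primrec₂.natPair.comp (Primrec.encode.comp Primrec.fst) hm
  have child : ∀ i : ℕ, Partrec fun p : Code × ℕ =>
      childFun (Nat.pair (Nat.pair (Encodable.encode p.1) p.2.unpair.1) i) := fun i =>
    partrec_childFun.comp (Primrec₂.natPair.comp hq (Primrec.const i)).to_comp
  refine (partrec₂_peval.comp (Primrec.fst.comp hu).to_comp (Primrec.snd.comp hu).to_comp).bind
    (((child 0).comp Computable.fst).bind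
      (((child 1).comp (Computable.fst.comp Computable.fst)).map ?_))
  exact (primrec_nodeCode (Primrec.snd.comp (Primrec.fst.comp Primrec.fst))
    (Primrec.snd.comp Primrec.fst) Primrec.snd
    (primrec₂_curryIndex.comp (Primrec.const _)
      (hq.comp (Primrec.fst.comp (Primrec.fst.comp Primrec.fst))))).to_comp

theorem primIndex_const {e b : ℕ} (h : ∀ n, peval e n = Part.some b) : PrimIndex e :=
  ⟨fun _ => b, Nat.Primrec.const b, h⟩

theorem cprecRep_omrep_const {e b : ℕ} (Γ : Finset Sentence) (h : ∀ n, peval e n = Part.some b)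
    (hb : CprecRep b) (hΓ : EndS b = Γ) : CprecRep (tup [omrepC, encS Γ, e]) := by
  refine CGen.omrep rfl Γ (primIndex_const h) (fun n => by simp [h n]) ?_ ?_ <;>
    intro n <;> simp only [h n, Part.get_some]
  exacts [hb, hΓ]

theorem endS_omrep (Γ : Finset Sentence) (e : ℕ) : EndS (tup [omrepC, encS Γ, e]) = Γ := by
  simp [EndS, proj, untup_tup, decS_encS]

theorem endS_delayedCode {f : ℕ → ℕ} (hf : IsOmegaProof f) {σ : ℕ} (hσ : TreeOf f σ) (c a : ℕ) :
    EndS (delayedCode c a σ (f σ)) = EndS (f σ) := by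
  rw [delayedCode, endCode_label hf hσ, endS_omrep]

theorem cprecRep_delayedCode {d c : Code} (hd : d.eval = childFun) (hc : c.eval = stepFun d c)
    {a : ℕ} {f : ℕ → ℕ} (hp : Nat.Primrec f) (ha : ∀ n, peval a n = Part.some (f n))
    (hf : IsOmegaProof f) {σ : ℕ} (hσ : TreeOf f σ)
    (ih : ∀ i, TreeOf f (snoc σ i) →
      CprecRep (delayedCode (Encodable.encode c) a (snoc σ i) (f (snoc σ i)))) :
    CprecRep (delayedCode (Encodable.encode c) a σ (f σ)) := by
  set ce := Encodable.encode c with hce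
  set H : ℕ → ℕ := fun i => delayedCode ce a (snoc σ i) (f (snoc σ i))
  set e := curryIndex (Encodable.encode d) (Nat.pair ce (Nat.pair a σ)) with he
  have hchild : ∀ i, childFun (Nat.pair (Nat.pair ce (Nat.pair a σ)) i) = Part.some (H i) := by
    intro i
    rw [childFun_pair, ha, Part.map_some]
  have hev : ∀ n, peval e n = Part.some (H n) := by
    intro n
    rw [he, peval_curryIndex, hd, hchild]
  have hep : PrimIndex e := by
    refine ⟨H, Primrec.nat_iff.1 ?_, hev⟩
    have hs : Primrec fun i => snoc σ i := primrec₂_snoc.comp (Primrec.const σ) Primrec.id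
    exact primrec_delayedCode (Primrec.const _) (Primrec.const _) hs
      ((Primrec.nat_iff.2 hp).comp hs)
  have hE : ∀ i, TreeOf f (snoc σ i) → EndS (H i) = EndS (f (snoc σ i)) := fun i hi =>
    endS_delayedCode hf hi _ _
  have hstep : ∀ n, peval (curryIndex ce (Nat.pair a σ)) n =
      Part.some (nodeCode (f σ) (H 0) (H 1) e) := by
    intro n
    rw [hce, peval_curryIndex, hc, stepFun]
    simp only [Nat.unpair_pair, ← hce, hchild, ha, Part.bind_some, Part.map_some, ← he]
  rw [delayedCode, endCode_label hf hσ]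
  by_cases h0 : TreeOf f (snoc σ 0)
  · rcases hf.inner σ hσ h0 with ⟨Γ, A, B, h, -, h1, -, e0, e1⟩ | ⟨Γ, A, B, h, -, -, e0⟩ |
      ⟨Γ, A, hA, h, hall, eall⟩ | ⟨Γ, A, hA, n, h, -, -, e0⟩ | ⟨Γ, C, h, -, h1, -, e0, e1⟩
    · have hn : nodeCode (f σ) (H 0) (H 1) e =
          tup [andC, encS Γ, encF (sAnd A B), H 0, H 1] := by
        simp [nodeCode, h, proj, untup_tup, axC, omC, orC, exC, andC]
      refine cprecRep_omrep_const _ hstep ?_ (by rw [hn, h]; simp [EndS, proj, untup_tup])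
      rw [hn]
      exact CGen.and Γ A B (ih 0 h0) (ih 1 h1) ((hE 0 h0).trans e0) ((hE 1 h1).trans e1)
    · have hn : nodeCode (f σ) (H 0) (H 1) e = tup [orC, encS Γ, encF (sOr A B), H 0] := by
        simp [nodeCode, h, proj, untup_tup, axC, omC, orC]
      refine cprecRep_omrep_const _ hstep ?_ (by rw [hn, h]; simp [EndS, proj, untup_tup])
      rw [hn]
      exact CGen.or Γ A B (ih 0 h0) ((hE 0 h0).trans e0)
    · have hn : nodeCode (f σ) (H 0) (H 1) e = tup [omC, encS Γ, encF (sAll A hA), e] := by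
        simp [nodeCode, h, proj, untup_tup, axC, omC]
      refine cprecRep_omrep_const _ hstep ?_ (by rw [hn, h]; simp [EndS, proj, untup_tup])
      rw [hn]
      refine CGen.om Γ A hA (fun _ => hep) (fun n => by simp [hev n]) ?_ ?_ <;>
        intro n <;> simp only [hev n, Part.get_some]
      exacts [ih n (hall n), (hE n (hall n)).trans (eall n)]
    · have hn : nodeCode (f σ) (H 0) (H 1) e = tup [exC, encS Γ, encF (sEx A hA), H 0] := by
        simp [nodeCode, h, proj, untup_tup, axC, omC, orC, exC]
      refine cprecRep_omrep_const _ hstep ?_ (by rw [hn, h]; simp [EndS, proj, untup_tup])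
      rw [hn]
      exact CGen.ex Γ A hA n (ih 0 h0) ((hE 0 h0).trans e0)
    · have hn : nodeCode (f σ) (H 0) (H 1) e = tup [cutC, encS Γ, encF C, H 0, H 1] := by
        simp [nodeCode, h, proj, untup_tup, axC, omC, orC, exC, cutC]
      refine cprecRep_omrep_const _ hstep ?_ (by rw [hn, h]; simp [EndS, proj, untup_tup])
      rw [hn]
      exact CGen.cut rfl Γ C (ih 0 h0) (ih 1 h1) ((hE 0 h0).trans e0) ((hE 1 h1).trans e1)
  · obtain ⟨Γ, hΓ, h⟩ := hf.top σ hσ h0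
    have hn : nodeCode (f σ) (H 0) (H 1) e = tup [axC, encS Γ] := by
      simp [nodeCode, h, proj, untup_tup]
    refine cprecRep_omrep_const _ hstep ?_ (by rw [hn, h])
    rw [hn]
    exact CGen.ax Γ hΓ

/-- **(pr2).**  There is a partial recursive `φ` such that if `a ∈ I_prec`
then `φ(a)` is defined, `φ(a) ∈ C_prec^{ω-rep}`, and the end sequent of
`φ(a)` is the end sequent of the `ω`-proof `⟨a⟩`. -/
theorem prim_index_to_code_with_rep :
    ∃ φ : ℕ →. ℕ, Nat.Partrec φ ∧
      ∀ (a : ℕ) (f : ℕ → ℕ), Nat.Primrec f → (∀ n, peval a n = Part.some (f n)) →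
        IsOmegaProof f →
        ∃ b : ℕ, b ∈ φ a ∧ CprecRep b ∧ EndS b = EndS (f rootSeq) := by
  obtain ⟨d, hd⟩ := Code.exists_code.1 (Partrec.nat_iff.1 partrec_childFun)
  obtain ⟨c, hc⟩ := Code.fixed_point₂ (partrec₂_stepFun d)
  refine ⟨fun a => (peval a rootSeq).map fun v => if v = 0 then tup [axC, encS (EndS 0)]
    else delayedCode (Encodable.encode c) a rootSeq v, Partrec.nat_iff.1 ?_, ?_⟩
  · refine (partrec₂_peval.comp Computable.id (Computable.const _)).map ?_
    exact (Primrec.ite (Primrec.eq.comp Primrec.snd (Primrec.const 0)) (Primrec.const _)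
      (primrec_delayedCode (Primrec.const _) Primrec.fst (Primrec.const _) Primrec.snd)).to_comp
  · intro a f hp ha hf
    simp only [ha, Part.map_some, Part.mem_some_iff, exists_eq_left]
    by_cases h : f rootSeq = 0
    · rw [if_pos h, h]
      exact ⟨CGen.ax _ isAxiom_endS_zero, by simp [EndS, proj, untup_tup, decS_encS]⟩
    · have hr : TreeOf f rootSeq := ⟨Nat.succ_ne_zero _, h⟩
      rw [if_neg h]
      exact ⟨hf.tree_induction
        (P := fun σ => CprecRep (delayedCode (Encodable.encode c) a σ (f σ)))
        (fun σ hσ ih => cprecRep_delayedCode hd hc hp ha hf hσ ih) hr,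
        endS_delayedCode hf hr _ _⟩

end Shoen
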